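/- Let Qbar be a fixed algebraic closure of ℚ, F ⊂ Qbar a number field of degree r over ℚ, and Σ = Hom_{ℚ-alg}(F, Qbar) the (r-element) set of ℚ-algebra homomorphisms from F to Qbar. Then there is an isomorphism of groups Aut_{F-alg}(F ⊗_ℚ Qbar) ≅ (Σ → Gal(Qbar/F)) ⋊ Perm(Σ), where Gal(Qbar/F) is the group of field automorphisms of Qbar fixing F pointwise, Perm(Σ) is the group of permutations of Σ acting on the product group Σ → Gal(Qbar/F) by permuting coordinates ((π · f)(τ) = f(π⁻¹(τ))), and Aut_{F-alg} denotes F-algebra automorphisms. -/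

import Mathlib

/-!
STATEMENT 4: Let `Qbar` be a fixed algebraic closure of `ℚ`, `F ⊂ Qbar` a number field of
degree `r` over `ℚ`, and `Σ = Hom_{ℚ-alg}(F, Qbar)` (an `r`-element set).  Then there is an
isomorphism of groups `Aut_{F-alg}(F ⊗_ℚ Qbar) ≅ (Σ → Gal(Qbar/F)) ⋊ Perm(Σ)`, where
`Perm(Σ)` acts on the product group by permuting coordinates.
-/

open scoped TensorProduct

noncomputable section

/-- A fixed algebraic closure of `ℚ`. -/
abbrev Qbar : Type := AlgebraicClosure ℚ

section PermAut

variable (σ H : Type) [Group H]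

/-- A permutation `π` of `σ` acts on the product group `σ → H` by permuting coordinates:
`(π • f) τ = f (π⁻¹ τ)`. -/
def permMulAut (π : Equiv.Perm σ) : MulAut (σ → H) where
  toFun f := f ∘ π.symm
  invFun f := f ∘ π
  left_inv f := by funext τ; simp
  right_inv f := by funext τ; simp
  map_mul' f g := rfl

/-- The permutation action of `Equiv.Perm σ` on the product group `σ → H`, as a homomorphism
to the automorphism group. -/
def permHom : Equiv.Perm σ →* MulAut (σ → H) where
  toFun := permMulAut σ H
  map_one' := rfl
  map_mul' _ _ := rfl

end PermAut

/-- The automorphism of `ι → K` attached to an element of the wreath product. -/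
def wreathAut (F K ι : Type) [Field F] [Field K] [Algebra F K]
    (f : ι → (K ≃ₐ[F] K)) (π : Equiv.Perm ι) :
    (ι → K) ≃ₐ[F] (ι → K) where
  toFun x τ := f τ (x (π.symm τ))
  invFun y τ := (f (π τ)).symm (y (π τ))
  left_inv x := by funext τ; simp
  right_inv x := by funext τ; simp
  map_mul' x y := by funext τ; simp
  map_add' x y := by funext τ; simp
  commutes' c := by funext τ; simp

def wreathHom (F K ι : Type) [Field F] [Field K] [Algebra F K] :
    ((ι → (K ≃ₐ[F] K)) ⋊[permHom ι (K ≃ₐ[F] K)] Equiv.Perm ι) →*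
      ((ι → K) ≃ₐ[F] (ι → K)) where
  toFun a := wreathAut F K ι a.left a.right
  map_one' := rfl
  map_mul' _ _ := by ext; rfl

theorem wreathHom_injective (F K ι : Type) [Field F] [Field K] [Algebra F K] :
    Function.Injective (wreathHom F K ι) := by
  classical
  intro a b h
  have key : ∀ (x : ι → K) (τ : ι),
      a.left τ (x (a.right.symm τ)) = b.left τ (x (b.right.symm τ)) := fun x τ =>
    congrFun (DFunLike.congr_fun h x) τ
  have h1 : a.left = b.left := by
    funext τ
    ext k
    exact key (fun _ => k) τ
  have h2 : a.right.symm = b.right.symm := by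
    ext τ
    by_contra hne
    have := key (Pi.single (a.right.symm τ) 1) τ
    rw [Pi.single_eq_same, Pi.single_eq_of_ne (Ne.symm hne)] at this
    simp at this
  exact SemidirectProduct.ext h1 (by simpa using congrArg Equiv.symm h2)

theorem wreathHom_surjective (F K ι : Type) [Field F] [Field K] [Algebra F K] [Finite ι] :
    Function.Surjective (wreathHom F K ι) := by
  classical
  have := Fintype.ofFinite ι
  intro e
  have hex : ∀ τ, ∃ i, e (Pi.single i 1) τ ≠ 0 := by
    intro τ
    by_contra! hc
    have h1 : (∑ i, Pi.single i (1 : K) : ι → K) = 1 := by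
      funext j; simp [Finset.sum_apply, Pi.single_apply]
    have h2 : e (∑ i, Pi.single i (1 : K)) τ = 1 := by rw [h1, map_one]; rfl
    rw [map_sum, Finset.sum_apply, Finset.sum_eq_zero (fun i _ => hc i)] at h2
    exact zero_ne_one h2
  choose p hp using hex
  have hdep : ∀ x y τ, x (p τ) = y (p τ) → e x τ = e y τ := by
    intro x y τ hxy
    have h1 : x * Pi.single (p τ) 1 = y * Pi.single (p τ) 1 := by
      funext j
      by_cases hj : j = p τ
      · subst hj; simp [hxy]
      · simp [Pi.single_eq_of_ne hj]
    have h2 := congrFun (congrArg e h1) τ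
    rw [map_mul, map_mul, Pi.mul_apply, Pi.mul_apply] at h2
    exact mul_right_cancel₀ (hp τ) h2
  let g : ι → (K →ₐ[F] K) := fun τ =>
    ((Pi.evalAlgHom F (fun _ : ι => K) τ).comp e.toAlgHom).comp
      (Pi.constAlgHom F ι K)
  have hg : ∀ x τ, e x τ = g τ (x (p τ)) := fun x τ => hdep _ _ _ rfl
  have hgb : ∀ τ, Function.Bijective (g τ) := by
    intro τ
    refine ⟨(g τ).toRingHom.injective, fun k => ?_⟩
    obtain ⟨x, hx⟩ := e.surjective (fun _ => k)
    exact ⟨x (p τ), by rw [← hg, hx]⟩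
  have hpinj : Function.Injective p := by
    intro τ τ' h
    by_contra hne
    obtain ⟨x, hx⟩ := e.surjective (Pi.single τ 1)
    have h1 := hg x τ
    have h2 := hg x τ'
    rw [hx, Pi.single_eq_same] at h1
    rw [hx, Pi.single_eq_of_ne (Ne.symm hne), ← h] at h2
    have h3 : x (p τ) = 0 := (hgb τ').1 (by rw [← h2, map_zero])
    rw [h3, map_zero] at h1
    exact one_ne_zero h1
  let π : Equiv.Perm ι := Equiv.ofBijective p (Finite.injective_iff_bijective.1 hpinj)
  refine ⟨⟨fun τ => AlgEquiv.ofBijective (g τ) (hgb τ), π.symm⟩, ?_⟩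
  ext x τ
  exact (hg x τ).symm

/-- The map `b ⊗ a ↦ (τ(a) b)_τ`. -/
def embMap (k F L : Type) [Field k] [Field F] [Field L] [Algebra k F] [Algebra k L] :
    (L ⊗[k] F) →ₐ[L] ((F →ₐ[k] L) → L) :=
  AlgHom.pi
    (fun τ => Algebra.TensorProduct.lift (AlgHom.id L L) τ (fun _ _ => Commute.all _ _))

theorem embMap_tmul (k F L : Type) [Field k] [Field F] [Field L] [Algebra k F] [Algebra k L]
    (a : F) (b : L) (τ : F →ₐ[k] L) : embMap k F L (b ⊗ₜ a) τ = b * τ a := by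
  simp [embMap]

theorem embMap_bijective (k F L : Type) [Field k] [Field F] [Field L] [Algebra k F] [Algebra k L]
    [FiniteDimensional k F] [Algebra.IsSeparable k F] [IsAlgClosed L] :
    Function.Bijective (embMap k F L) := by
  classical
  have hs : Function.Surjective (embMap k F L).toLinearMap := by
    rw [← LinearMap.range_eq_top]
    by_contra hne
    obtain ⟨c, hc, hle⟩ := Submodule.exists_le_ker_of_lt_top _ (lt_top_iff_ne_top.2 hne)
    apply hc
    have hind := linearIndependent_toLinearMap k F L
    rw [Fintype.linearIndependent_iff] at hind
    have h0 := hind (fun τ => c (Pi.single τ 1)) (by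
      ext a
      have h1 : c (embMap k F L (1 ⊗ₜ a)) = 0 := hle ⟨1 ⊗ₜ a, rfl⟩
      have h2 : embMap k F L (1 ⊗ₜ a) = ∑ τ : F →ₐ[k] L, τ a • Pi.single τ (1 : L) := by
        funext τ
        rw [embMap_tmul]
        simp [Finset.sum_apply, Pi.single_apply]
      rw [h2, map_sum] at h1
      simpa [mul_comm] using h1)
    refine LinearMap.pi_ext' fun τ => LinearMap.ext_ring ?_
    simpa using h0 τ
  have hd : Module.finrank L (L ⊗[k] F) = Module.finrank L ((F →ₐ[k] L) → L) := by
    rw [Module.finrank_baseChange, Module.finrank_fintype_fun_eq_card, AlgHom.card]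
  exact ⟨(LinearMap.injective_iff_surjective_of_finrank_eq_finrank hd).2 hs, hs⟩

theorem qbar_isAlgebraic : Algebra.IsAlgebraic ℚ Qbar := by
  have h := AlgebraicClosure.isAlgebraic ℚ
  have e : (DivisionRing.toRatAlgebra : Algebra ℚ Qbar) = AlgebraicClosure.instAlgebra ℚ :=
    Subsingleton.elim _ _
  rw [← e] at h
  exact h

theorem exists_twist (F : IntermediateField ℚ Qbar) (τ : F →ₐ[ℚ] Qbar) :
    ∃ s : Qbar ≃ₐ[ℚ] Qbar, ∀ a : F, s a = τ a := by
  have := qbar_isAlgebraic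
  obtain ⟨f, hf⟩ := IntermediateField.exists_algHom_of_splits (E := Qbar) (K := Qbar)
    (fun x : Qbar => ⟨Algebra.IsIntegral.isIntegral x, IsAlgClosed.splits _⟩) τ
  refine ⟨AlgEquiv.ofBijective f (Algebra.IsAlgebraic.algHom_bijective f), fun a => ?_⟩
  rw [← hf]
  rfl

/-- The `τ`-component `a ⊗ b ↦ a s(b)`. -/
def compMap (F : IntermediateField ℚ Qbar) (s : Qbar ≃ₐ[ℚ] Qbar) :
    (F ⊗[ℚ] Qbar) →ₐ[F] Qbar :=
  Algebra.TensorProduct.lift (Algebra.ofId F Qbar) s.toAlgHom (fun _ _ => Commute.all _ _)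

theorem exists_split (F : IntermediateField ℚ Qbar) [FiniteDimensional ℚ F] :
    Nonempty ((F ⊗[ℚ] Qbar) ≃ₐ[F] ((F →ₐ[ℚ] Qbar) → Qbar)) := by
  choose s hs using exists_twist F
  let φ : (F ⊗[ℚ] Qbar) →ₐ[F] ((F →ₐ[ℚ] Qbar) → Qbar) :=
    AlgHom.pi (fun τ => compMap F (s τ).symm)
  have hφ : ∀ x τ, s τ (φ x τ) =
      embMap ℚ F Qbar (Algebra.TensorProduct.comm ℚ F Qbar x) τ := by
    intro x τ
    induction x with
    | zero => simp
    | add x y hx hy => rw [map_add, map_add, map_add, Pi.add_apply, Pi.add_apply, map_add, hx, hy]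
    | tmul a b =>
      rw [Algebra.TensorProduct.comm_tmul, embMap_tmul, ← hs]
      have h1 : φ (a ⊗ₜ b) τ = (a : Qbar) * (s τ).symm b :=
        Algebra.TensorProduct.lift_tmul (Algebra.ofId F Qbar) (s τ).symm.toAlgHom
          (fun _ _ => Commute.all _ _) a b
      rw [h1, map_mul, AlgEquiv.apply_symm_apply, mul_comm]
  have hb := (embMap_bijective ℚ F Qbar).comp (Algebra.TensorProduct.comm ℚ F Qbar).bijective
  refine ⟨AlgEquiv.ofBijective φ ⟨fun x y h => hb.1 ?_, fun y => ?_⟩⟩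
  · funext τ
    change embMap ℚ F Qbar (Algebra.TensorProduct.comm ℚ F Qbar x) τ =
      embMap ℚ F Qbar (Algebra.TensorProduct.comm ℚ F Qbar y) τ
    rw [← hφ, ← hφ, h]
  · obtain ⟨x, hx⟩ := hb.2 (fun τ => s τ (y τ))
    refine ⟨x, funext fun τ => (s τ).injective ?_⟩
    rw [hφ]
    exact congrFun hx τ

set_option synthInstance.maxHeartbeats 1000000 in
set_option maxHeartbeats 1000000 in
theorem statement4 (F : IntermediateField ℚ Qbar) [FiniteDimensional ℚ F]
    (r : ℕ) (hr : Module.finrank ℚ F = r) :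
    Nonempty
      (((F ⊗[ℚ] Qbar) ≃ₐ[F] (F ⊗[ℚ] Qbar)) ≃*
        ((F →ₐ[ℚ] Qbar) → (Qbar ≃ₐ[F] Qbar))
          ⋊[permHom (F →ₐ[ℚ] Qbar) (Qbar ≃ₐ[F] Qbar)] Equiv.Perm (F →ₐ[ℚ] Qbar)) := by
  obtain ⟨e⟩ := exists_split F
  exact ⟨e.autCongr.trans (MulEquiv.ofBijective (wreathHom F Qbar (F →ₐ[ℚ] Qbar))
    ⟨wreathHom_injective _ _ _, wreathHom_surjective _ _ _⟩).symm⟩
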